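/- Let m, n ≥ 2 be natural numbers and let E be a finite group with a normal subgroup N such that N is cyclic of order n and the quotient E/N is cyclic of order m. Then E is cyclic if and only if E is abelian and there exist a generator a of N, an element b ∈ E whose image generates E/N, and an integer i with b^m = a^i and gcd(i, gcd(m, n)) = 1. -/

import Mathlib

/-- If no prime divides all of `i`, `m` and `n`, then the progression `i + m * k` meets the
integers coprime to `n`. -/
theorem exists_isCoprime_add_mul {i : ℤ} {m n : ℕ} (hn : n ≠ 0)
    (h : Int.gcd i (Nat.gcd m n : ℤ) = 1) : ∃ k : ℤ, IsCoprime (i + m * k) (n : ℤ) := by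
  refine ⟨((∏ p ∈ n.primeFactors with ¬ ((p : ℕ) : ℤ) ∣ i, p : ℕ) : ℤ), ?_⟩
  rw [Int.isCoprime_iff_gcd_eq_one]
  by_contra hne
  obtain ⟨p, hp, hpd⟩ := Nat.exists_prime_and_dvd hne
  have hpZ : Prime (p : ℤ) := Nat.prime_iff_prime_int.mp hp
  have hsum := (Int.natCast_dvd_natCast.mpr hpd).trans (Int.gcd_dvd_left _ _)
  have hpn : p ∣ n :=
    Int.natCast_dvd_natCast.mp ((Int.natCast_dvd_natCast.mpr hpd).trans (Int.gcd_dvd_right _ _))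
  by_cases hpi : (p : ℤ) ∣ i
  · rcases hpZ.dvd_or_dvd ((dvd_add_right hpi).mp hsum) with hpm | hpk
    · have hdvd : p ∣ Int.gcd i (Nat.gcd m n : ℤ) :=
        Int.dvd_gcd hpi (Int.natCast_dvd_natCast.mpr
          (Nat.dvd_gcd (Int.natCast_dvd_natCast.mp hpm) hpn))
      exact hp.one_lt.ne' (Nat.dvd_one.mp (h ▸ hdvd))
    · obtain ⟨q, hq, hpq⟩ := (Prime.dvd_finsetProd_iff hp.prime _).mp
        (Int.natCast_dvd_natCast.mp hpk)
      rw [Finset.mem_filter] at hq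
      rw [Nat.prime_dvd_prime_iff_eq hp (Nat.prime_of_mem_primeFactors hq.1)] at hpq
      exact hq.2 (hpq ▸ hpi)
  · have hpk : p ∣ ∏ p ∈ n.primeFactors with ¬ ((p : ℕ) : ℤ) ∣ i, p :=
      Finset.dvd_prod_of_mem (fun q : ℕ => q)
        (Finset.mem_filter.mpr ⟨Nat.mem_primeFactors.mpr ⟨hp, hpn, hn⟩, hpi⟩)
    exact hpi ((dvd_add_left ((Int.natCast_dvd_natCast.mpr hpk).mul_left _)).mp hsum)

/-- A power of `a` whose exponent is coprime to the order of `a` generates `a`. -/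
theorem mem_zpowers_zpow_of_isCoprime {G : Type*} [Group G] {a : G} {j : ℤ}
    (h : IsCoprime j (orderOf a : ℤ)) : a ∈ Subgroup.zpowers (a ^ j) := by
  obtain ⟨u, v, huv⟩ := h
  refine ⟨u, ?_⟩
  have : a ^ (u * j + v * orderOf a) = a := by rw [huv, zpow_one]
  rw [zpow_add, mul_comm v, zpow_mul a (orderOf a : ℤ), zpow_natCast, pow_orderOf_eq_one,
    one_zpow, mul_one, mul_comm, zpow_mul] at this
  exact this


/-- A finite group `E` with a normal subgroup `N` cyclic of order `n` and cyclic quotient of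
order `m` is cyclic iff `E` is abelian and there are a generator `a` of `N`, an element `b`
whose image generates `E ⧸ N`, and an integer `i` with `bᵐ = aⁱ` and
`gcd(i, gcd(m, n)) = 1`. -/
theorem extension_of_finite_cyclics_isCyclic_iff
    (m n : ℕ) (hm : 2 ≤ m) (hn : 2 ≤ n)
    (E : Type*) [Group E] [Finite E] (N : Subgroup E) [N.Normal]
    (hNcyc : IsCyclic N) (hNcard : Nat.card N = n)
    (hQcyc : IsCyclic (E ⧸ N)) (hQcard : Nat.card (E ⧸ N) = m) :
    IsCyclic E ↔
      ((∀ x y : E, x * y = y * x) ∧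
        ∃ (a b : E) (i : ℤ),
          Subgroup.zpowers a = N ∧
          Subgroup.zpowers (QuotientGroup.mk b : E ⧸ N) = ⊤ ∧
          b ^ m = a ^ i ∧ Int.gcd i (Nat.gcd m n : ℤ) = 1) := by
  constructor
  · intro hE
    obtain ⟨g, hg⟩ := hE.exists_generator
    have hgtop : Subgroup.zpowers g = ⊤ := (Subgroup.eq_top_iff' _).mpr hg
    have hmem : g ^ m ∈ N := by
      rw [← QuotientGroup.eq_one_iff, QuotientGroup.mk_pow, ← hQcard, pow_card_eq_one']
    have hord : orderOf g = m * n := by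
      rw [orderOf_eq_card_of_forall_mem_zpowers hg, N.card_eq_card_quotient_mul_card_subgroup,
        hQcard, hNcard]
    refine ⟨fun x y => IsCyclic.isMulCommutative.is_comm.comm x y, g ^ m, g, 1, ?_, ?_, by simp,
      by simp⟩
    · refine Subgroup.eq_of_le_of_card_ge ((Subgroup.zpowers_le).mpr hmem) ?_
      rw [Nat.card_zpowers, orderOf_pow_of_dvd (by omega) (hord ▸ dvd_mul_right m n), hord,
        hNcard, Nat.mul_div_cancel_left n (by omega)]
    · rw [← QuotientGroup.mk'_apply, ← MonoidHom.map_zpowers, hgtop]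
      exact Subgroup.map_top_of_surjective _ (QuotientGroup.mk'_surjective N)
  · rintro ⟨hcomm, a, b, i, ha, hb, hbi, hgcd⟩
    obtain ⟨k, hk⟩ := exists_isCoprime_add_mul (by omega) hgcd
    have haN : a ∈ N := ha ▸ Subgroup.mem_zpowers a
    have hord : orderOf a = n := by rw [← Nat.card_zpowers, ha, hNcard]
    have hpow : (b * a ^ k) ^ m = a ^ (i + m * k) := by
      rw [Commute.mul_pow (hcomm b (a ^ k)), hbi, zpow_add, mul_comm (m : ℤ), zpow_mul,
        zpow_natCast]
    have hN : N ≤ Subgroup.zpowers (b * a ^ k) := by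
      rw [← ha, Subgroup.zpowers_le]
      have h := mem_zpowers_zpow_of_isCoprime (a := a) (hord ▸ hk)
      rw [← hpow] at h
      exact (Subgroup.zpowers_le.mpr (Subgroup.npow_mem_zpowers _ m)) h
    have hc : (QuotientGroup.mk (b * a ^ k) : E ⧸ N) = QuotientGroup.mk b :=
      QuotientGroup.mk_mul_of_mem b (N.zpow_mem haN k)
    refine ⟨b * a ^ k, fun x => ?_⟩
    have hx : (QuotientGroup.mk x : E ⧸ N) ∈
        Subgroup.zpowers (QuotientGroup.mk (b * a ^ k) : E ⧸ N) := by
      rw [hc, hb]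
      exact Subgroup.mem_top _
    obtain ⟨j, hj⟩ := Subgroup.mem_zpowers_iff.mp hx
    rw [← QuotientGroup.mk_zpow, QuotientGroup.eq] at hj
    exact (Subgroup.mul_mem_cancel_left _
      (inv_mem (Subgroup.zpow_mem_zpowers (b * a ^ k) j))).mp (hN hj)
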